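/- Bonami's lemma: let f : {-1,1}^n → ℝ be given by a multilinear polynomial of degree at most d, i.e., f(x) = Σ_{S ⊆ [n], |S| ≤ d} c_S ∏_{i∈S} x_i. Then E_x[f(x)^4] ≤ 9^d · (E_x[f(x)^2])^2, where x is uniform on {-1,1}^n. Equivalently, ‖f‖_4 ≤ √3^d · ‖f‖_2. -/

import Mathlib

open Finset

/-- The real value of a cube coordinate: `true ↦ 1`, `false ↦ -1`. -/
noncomputable def bR (b : Bool) : ℝ := if b then 1 else -1

/-- Expectation over a uniformly random point of the cube `{-1,1}ⁿ`. -/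
noncomputable def expect {n : ℕ} (g : (Fin n → Bool) → ℝ) : ℝ :=
  (∑ x : Fin n → Bool, g x) / 2 ^ n

/-- The character `χ_S(x) = ∏_{i ∈ S} x i`. -/
noncomputable def chi {n : ℕ} (S : Finset (Fin n)) (x : Fin n → Bool) : ℝ :=
  ∏ i ∈ S, bR (x i)

/-- The Fourier coefficient `f̂(S) = E[f(x) χ_S(x)]`. -/
noncomputable def fhat {n : ℕ} (f : (Fin n → Bool) → ℝ) (S : Finset (Fin n)) : ℝ :=
  expect fun x => f x * chi S x

theorem bR_sq (b : Bool) : bR b ^ 2 = 1 := by cases b <;> simp [bR]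

theorem bR_not (b : Bool) : bR (!b) = -bR b := by cases b <;> simp [bR]

section Expectation

variable {n : ℕ}

theorem expect_add (g h : (Fin n → Bool) → ℝ) :
    (expect fun x => g x + h x) = expect g + expect h := by
  simp only [_root_.expect, sum_add_distrib, add_div]

theorem expect_const_mul (a : ℝ) (g : (Fin n → Bool) → ℝ) :
    (expect fun x => a * g x) = a * expect g := by
  simp only [_root_.expect, ← mul_sum, mul_div_assoc]

theorem expect_const (a : ℝ) : (expect fun _ : Fin n → Bool => a) = a := by
  simp [_root_.expect]

theorem expect_nonneg {g : (Fin n → Bool) → ℝ} (hg : ∀ x, 0 ≤ g x) : 0 ≤ expect g :=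
  div_nonneg (sum_nonneg fun x _ => hg x) (by positivity)

theorem expect_mul_sq_le (g h : (Fin n → Bool) → ℝ) :
    (expect fun x => g x * h x) ^ 2 ≤ (expect fun x => g x ^ 2) * expect fun x => h x ^ 2 := by
  simp only [_root_.expect, div_pow, div_mul_div_comm, ← sq]
  gcongr
  exact sum_mul_sq_le_sq_mul_sq _ _ _

/-- Negation of the `i`-th coordinate of a point of the cube. -/
def flipCoord (i : Fin n) (x : Fin n → Bool) : Fin n → Bool := Function.update x i (!x i)

theorem flipCoord_flipCoord (i : Fin n) (x : Fin n → Bool) : flipCoord i (flipCoord i x) = x := by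
  simp [flipCoord]

theorem expect_flipCoord (i : Fin n) (g : (Fin n → Bool) → ℝ) :
    (expect fun x => g (flipCoord i x)) = expect g := by
  simp only [_root_.expect]
  congr 1
  exact Equiv.sum_comp (Function.Involutive.toPerm (flipCoord i) (flipCoord_flipCoord i)) g

theorem expect_bR_mul_eq_zero {i : Fin n} {g : (Fin n → Bool) → ℝ}
    (hg : ∀ x, g (flipCoord i x) = g x) : (expect fun x => bR (x i) * g x) = 0 := by
  have h := expect_flipCoord i fun x => bR (x i) * g x
  have h' : (expect fun x => bR (flipCoord i x i) * g (flipCoord i x)) =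
      expect fun x => -1 * (bR (x i) * g x) := by
    congr 1
    funext x
    rw [hg, flipCoord, Function.update_self, bR_not]
    ring
  rw [h', expect_const_mul] at h
  linarith

theorem chi_flipCoord {i : Fin n} {S : Finset (Fin n)} (hi : i ∉ S) (x : Fin n → Bool) :
    chi S (flipCoord i x) = chi S x := by
  refine prod_congr rfl fun j hj => ?_
  rw [flipCoord, Function.update_of_ne (ne_of_mem_of_not_mem hj hi)]

theorem expect_add_bR_mul_sq {i : Fin n} {g h : (Fin n → Bool) → ℝ}
    (hg : ∀ x, g (flipCoord i x) = g x) (hh : ∀ x, h (flipCoord i x) = h x) :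
    (expect fun x => (g x + bR (x i) * h x) ^ 2) =
      (expect fun x => g x ^ 2) + expect fun x => h x ^ 2 := by
  have expand : (fun x => (g x + bR (x i) * h x) ^ 2) =
      fun x => (g x ^ 2 + h x ^ 2) + bR (x i) * (2 * (g x * h x)) := by
    funext x
    linear_combination h x ^ 2 * bR_sq (x i)
  rw [expand, expect_add, expect_add, expect_bR_mul_eq_zero fun x => by rw [hg, hh], add_zero]

theorem expect_add_bR_mul_pow_four {i : Fin n} {g h : (Fin n → Bool) → ℝ}
    (hg : ∀ x, g (flipCoord i x) = g x) (hh : ∀ x, h (flipCoord i x) = h x) :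
    (expect fun x => (g x + bR (x i) * h x) ^ 4) =
      (expect fun x => g x ^ 4) + 6 * (expect fun x => g x ^ 2 * h x ^ 2) +
        expect fun x => h x ^ 4 := by
  have expand : (fun x => (g x + bR (x i) * h x) ^ 4) =
      fun x => (g x ^ 4 + 6 * (g x ^ 2 * h x ^ 2) + h x ^ 4) +
        bR (x i) * (4 * (g x ^ 3 * h x + g x * h x ^ 3)) := by
    funext x
    linear_combination (6 * g x ^ 2 * h x ^ 2 + 4 * bR (x i) * g x * h x ^ 3 +
      h x ^ 4 * (bR (x i) ^ 2 + 1)) * bR_sq (x i)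
  rw [expand, expect_add, expect_add, expect_add, expect_const_mul,
    expect_bR_mul_eq_zero fun x => by rw [hg, hh], add_zero]

/-- The inductive step of Bonami's lemma, for `g + x i * h` with `g`, `h` independent of `x i`. -/
theorem expect_add_bR_mul_pow_four_le {i : Fin n} {g h : (Fin n → Bool) → ℝ} {d : ℕ}
    (hg : ∀ x, g (flipCoord i x) = g x) (hh : ∀ x, h (flipCoord i x) = h x)
    (hg4 : (expect fun x => g x ^ 4) ≤ 9 ^ (d + 1) * (expect fun x => g x ^ 2) ^ 2)
    (hh4 : (expect fun x => h x ^ 4) ≤ 9 ^ d * (expect fun x => h x ^ 2) ^ 2) :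
    (expect fun x => (g x + bR (x i) * h x) ^ 4) ≤
      9 ^ (d + 1) * (expect fun x => (g x + bR (x i) * h x) ^ 2) ^ 2 := by
  rw [expect_add_bR_mul_pow_four hg hh, expect_add_bR_mul_sq hg hh]
  have cauchy := expect_mul_sq_le (fun x => g x ^ 2) (fun x => h x ^ 2)
  simp only [← pow_mul, Nat.reduceMul] at cauchy
  have hg2 : 0 ≤ expect fun x => g x ^ 2 := expect_nonneg fun x => sq_nonneg _
  have hh2 : 0 ≤ expect fun x => h x ^ 2 := expect_nonneg fun x => sq_nonneg _
  have hh4_nonneg : 0 ≤ expect fun x => h x ^ 4 := expect_nonneg fun x => by positivity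
  generalize (expect fun x => g x ^ 2) = a at *
  generalize (expect fun x => h x ^ 2) = b at *
  have cross : (expect fun x => g x ^ 2 * h x ^ 2) ≤ 3 * 9 ^ d * (a * b) := by
    refine le_of_sq_le_sq ?_ (by positivity)
    calc _ ≤ _ := cauchy
      _ ≤ (9 ^ (d + 1) * a ^ 2) * (9 ^ d * b ^ 2) :=
        mul_le_mul hg4 hh4 hh4_nonneg (by positivity)
      _ = _ := by ring
  have hb : 0 ≤ (9 : ℝ) ^ d * b ^ 2 := by positivity
  rw [pow_succ] at hg4 ⊢
  linarith

/-- Bonami's lemma for polynomials in the variables indexed by `A`. -/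
theorem expect_sum_powerset_pow_four_le (A : Finset (Fin n)) (d : ℕ) (c : Finset (Fin n) → ℝ)
    (hdeg : ∀ S ⊆ A, d < #S → c S = 0) :
    (expect fun x => (∑ S ∈ A.powerset, c S * chi S x) ^ 4) ≤
      9 ^ d * (expect fun x => (∑ S ∈ A.powerset, c S * chi S x) ^ 2) ^ 2 := by
  induction A using Finset.induction_on generalizing d c with
  | empty =>
    simp only [powerset_empty, sum_singleton, chi, prod_empty, expect_const]
    rw [← pow_mul]
    exact le_mul_of_one_le_left (by positivity) (one_le_pow₀ (by norm_num))
  | insert i A hi ih =>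
    have not_mem {S : Finset (Fin n)} (hS : S ∈ A.powerset) : i ∉ S :=
      fun h => hi (mem_powerset.mp hS h)
    have flipCoord_inv (c : Finset (Fin n) → ℝ) (x : Fin n → Bool) :
        ∑ S ∈ A.powerset, c S * chi S (flipCoord i x) = ∑ S ∈ A.powerset, c S * chi S x :=
      sum_congr rfl fun S hS => by rw [chi_flipCoord (not_mem hS)]
    have split (x : Fin n → Bool) : ∑ S ∈ (insert i A).powerset, c S * chi S x =
        (∑ S ∈ A.powerset, c S * chi S x) +
          bR (x i) * ∑ S ∈ A.powerset, c (insert i S) * chi S x := by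
      rw [sum_powerset_insert hi, mul_sum]
      congr 1
      refine sum_congr rfl fun S hS => ?_
      rw [chi, prod_insert (not_mem hS), chi]
      ring
    have hdeg_insert {S : Finset (Fin n)} (hS : S ⊆ A) (hd : d < #S + 1) :
        c (insert i S) = 0 :=
      hdeg _ (insert_subset_insert i hS)
        (by rwa [card_insert_of_notMem (not_mem (mem_powerset.mpr hS))])
    have ih_left := ih d c fun S hS => hdeg S (hS.trans (subset_insert i A))
    simp only [split]
    cases d with
    | zero =>
      have vanish (x : Fin n → Bool) : ∑ S ∈ A.powerset, c (insert i S) * chi S x = 0 :=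
        sum_eq_zero fun S hS => by
          rw [hdeg_insert (mem_powerset.mp hS) (Nat.succ_pos _), zero_mul]
      simpa only [vanish, mul_zero, add_zero] using ih_left
    | succ d =>
      exact expect_add_bR_mul_pow_four_le (flipCoord_inv c) (flipCoord_inv fun S => c (insert i S))
        ih_left
        (ih d (fun S => c (insert i S)) fun S hS hd =>
          hdeg_insert hS (Nat.succ_lt_succ hd))

end Expectation

/-- **Bonami's lemma.** If `f : {-1,1}ⁿ → ℝ` is a multilinear polynomial of degree at
most `d`, then `E[f⁴] ≤ 9^d (E[f²])²`, i.e. `‖f‖₄ ≤ √3^d ‖f‖₂`. -/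
theorem bonami_lemma (n d : ℕ) (c : Finset (Fin n) → ℝ)
    (hdeg : ∀ S : Finset (Fin n), d < S.card → c S = 0)
    (f : (Fin n → Bool) → ℝ)
    (hf : ∀ x, f x = ∑ S : Finset (Fin n), c S * chi S x) :
    (expect fun x => f x ^ 4) ≤ 9 ^ d * (expect fun x => f x ^ 2) ^ 2 := by
  obtain rfl : f = fun x => ∑ S : Finset (Fin n), c S * chi S x := funext hf
  simpa only [powerset_univ] using
    expect_sum_powerset_pow_four_le univ d c fun S _ => hdeg S
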